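/- If the left Λ-module U is k-Gorenstein, then for every 0 ≤ i ≤ k−1 the functor Ext^i_Λ(Ext^i_Γ(−,U),U) : mod Γ^op → mod Γ^op preserves monomorphisms; that is, for every exact sequence 0 → X → Y in mod Γ^op the induced map Ext^i_Λ(Ext^i_Γ(X,U),U) → Ext^i_Λ(Ext^i_Γ(Y,U),U) is a monomorphism. -/

import Mathlib

/-! Common definitions: concrete Ext groups (via the canonical free resolution) of a module
over a ring `R` with coefficients in an `(R,S)`-bimodule `U`, carrying their natural
`S`-module structure; grades, Gorenstein conditions, resolution dimensions, etc. -/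

noncomputable section

namespace GorPaper

section Ext

variable (R : Type) [Ring R]

/-- The canonical free cover `R^(M) → M` of a module. -/
def cover (M : Type) [AddCommGroup M] [Module R M] : (M →₀ R) →ₗ[R] M :=
  Finsupp.linearCombination R (_root_.id : M → M)

/-- The syzygy modules of `M` along its canonical free resolution:
`syz R M 0 = M` and `syz R M (n+1) = ker (R^(syz R M n) → syz R M n)`. -/
def syz (M : ModuleCat.{0} R) : ℕ → ModuleCat.{0} R
  | 0 => M
  | n + 1 => ModuleCat.of R (LinearMap.ker (cover R (syz M n)))

variable {R} in
/-- Functoriality of the free cover. -/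
def freeMap {M N : Type} [AddCommGroup M] [Module R M] [AddCommGroup N] [Module R N]
    (f : M →ₗ[R] N) : (M →₀ R) →ₗ[R] (N →₀ R) :=
  Finsupp.lmapDomain R R f

lemma cover_comp_freeMap {M N : Type} [AddCommGroup M] [Module R M] [AddCommGroup N]
    [Module R N] (f : M →ₗ[R] N) : (cover R N).comp (freeMap f) = f.comp (cover R M) := by
  ext a
  simp [cover, freeMap, Finsupp.linearCombination_single]

lemma freeMap_ker {M N : Type} [AddCommGroup M] [Module R M] [AddCommGroup N] [Module R N]
    (f : M →ₗ[R] N) :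
    ∀ x ∈ LinearMap.ker (cover R M), freeMap f x ∈ LinearMap.ker (cover R N) := by
  intro x hx
  have := congrArg (fun g => g x) (cover_comp_freeMap R f)
  simp only [LinearMap.comp_apply] at this
  simp only [LinearMap.mem_ker] at hx ⊢
  rw [this, hx, map_zero]

variable {R} in
/-- The induced map on first syzygies. -/
def kerMap {M N : Type} [AddCommGroup M] [Module R M] [AddCommGroup N] [Module R N]
    (f : M →ₗ[R] N) :
    ↥(LinearMap.ker (cover R M)) →ₗ[R] ↥(LinearMap.ker (cover R N)) :=
  (freeMap f).restrict (freeMap_ker R f)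

variable {R} in
/-- The induced map on `n`-th syzygies. -/
def syzMap {M N : ModuleCat.{0} R} (f : ↥M →ₗ[R] ↥N) :
    ∀ n, ↥(syz R M n) →ₗ[R] ↥(syz R N n)
  | 0 => f
  | n + 1 => kerMap (syzMap f n)

variable (S : Type) [Ring S]
variable (U : Type) [AddCommGroup U] [Module R U] [Module S U] [SMulCommClass R S U]

/-- Precomposition `Hom_R(B,U) → Hom_R(A,U)`, as an `S`-linear map (where the `S`-module
structures come from the right `S`-structure of the bimodule `U`). -/
def precompS {A B : Type} [AddCommMonoid A] [Module R A] [AddCommMonoid B] [Module R B]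
    (t : A →ₗ[R] B) : (B →ₗ[R] U) →ₗ[S] (A →ₗ[R] U) where
  toFun g := g.comp t
  map_add' g h := LinearMap.add_comp _ _ _
  map_smul' s g := LinearMap.smul_comp _ _ _

/-- The submodule of `Hom_R(Ω N, U)` consisting of those homomorphisms which extend to
the free cover of `N`. -/
def ext1Sub (N : Type) [AddCommGroup N] [Module R N] :
    Submodule S (↥(LinearMap.ker (cover R N)) →ₗ[R] U) :=
  LinearMap.range (precompS R S U (LinearMap.ker (cover R N)).subtype)

/-- `Ext¹_R(N, U)`, as an `S`-module. -/
def Ext1 (N : Type) [AddCommGroup N] [Module R N] : Type :=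
  (↥(LinearMap.ker (cover R N)) →ₗ[R] U) ⧸ ext1Sub R S U N

instance (N : Type) [AddCommGroup N] [Module R N] : AddCommGroup (Ext1 R S U N) :=
  inferInstanceAs (AddCommGroup (_ ⧸ ext1Sub R S U N))

instance (N : Type) [AddCommGroup N] [Module R N] : Module S (Ext1 R S U N) :=
  inferInstanceAs (Module S (_ ⧸ ext1Sub R S U N))

/-- `Ext^n_R(M, U)`, as an `S`-module: `Ext⁰ = Hom_R(M,U)` and
`Ext^{n+1}(M,U) = Ext¹(Ω^n M, U)` (dimension shifting along the canonical free
resolution of `M`). -/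
def ExtU (M : ModuleCat.{0} R) : ℕ → Type
  | 0 => ↥M →ₗ[R] U
  | n + 1 => Ext1 R S U ↥(syz R M n)

instance (M : ModuleCat.{0} R) (n : ℕ) : AddCommGroup (ExtU R S U M n) :=
  match n with
  | 0 => inferInstanceAs (AddCommGroup (↥M →ₗ[R] U))
  | n + 1 => inferInstanceAs (AddCommGroup (Ext1 R S U ↥(syz R M n)))

instance (M : ModuleCat.{0} R) (n : ℕ) : Module S (ExtU R S U M n) :=
  match n with
  | 0 => inferInstanceAs (Module S (↥M →ₗ[R] U))
  | n + 1 => inferInstanceAs (Module S (Ext1 R S U ↥(syz R M n)))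

lemma ext1Sub_le_comap {M N : Type} [AddCommGroup M] [Module R M] [AddCommGroup N]
    [Module R N] (f : M →ₗ[R] N) :
    ext1Sub R S U N ≤ (ext1Sub R S U M).comap (precompS R S U (kerMap f)) := by
  rintro g ⟨h, rfl⟩
  exact ⟨precompS R S U (freeMap f) h, LinearMap.ext fun x => rfl⟩

variable {R} in
/-- Contravariant functoriality of `Ext¹`. -/
def ext1Map {M N : Type} [AddCommGroup M] [Module R M] [AddCommGroup N] [Module R N]
    (f : M →ₗ[R] N) : Ext1 R S U N →ₗ[S] Ext1 R S U M :=
  Submodule.mapQ _ _ (precompS R S U (kerMap f)) (ext1Sub_le_comap R S U f)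

variable {R} in
/-- Contravariant functoriality of `Ext^n`: the map
`Ext^n_R(N,U) → Ext^n_R(M,U)` induced by `f : M → N`; it is `S`-linear. -/
def extMap {M N : ModuleCat.{0} R} (f : ↥M →ₗ[R] ↥N) :
    ∀ n, ExtU R S U N n →ₗ[S] ExtU R S U M n
  | 0 => precompS R S U f
  | n + 1 => ext1Map S U (syzMap f n)

/-- `Ext^n_R(M,U) = 0`. -/
def extVanish (M : ModuleCat.{0} R) (n : ℕ) : Prop :=
  Subsingleton (ExtU R S U M n)

/-- `grade_U M ≥ i` : `Ext^j_R(M,U) = 0` for all `j < i`. -/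
def gradeGE (M : ModuleCat.{0} R) (i : ℕ) : Prop :=
  ∀ j < i, extVanish R S U M j

/-- `grade_U M = g` : `grade_U M ≥ g` and `Ext^g_R(M,U) ≠ 0`. -/
def gradeEq (M : ModuleCat.{0} R) (g : ℕ) : Prop :=
  gradeGE R S U M g ∧ ¬ extVanish R S U M g

/-- `s.grade_U M ≥ i` : `grade_U B ≥ i` for every submodule `B` of `M`. -/
def sgradeGE (M : ModuleCat.{0} R) (i : ℕ) : Prop :=
  ∀ B : Submodule R ↥M, gradeGE R S U (ModuleCat.of R ↥B) i

/-- Membership in `H_g` : `grade_U M = g` and `Ext^i(M,U) = 0` for all `i ≠ g`. -/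
def Hmem (M : ModuleCat.{0} R) (g : ℕ) : Prop :=
  gradeEq R S U M g ∧ ∀ i, i ≠ g → extVanish R S U M i

/-- The functor `Ext^i_S(Ext^i_R(-,U),U) : mod R → mod R` preserves monomorphisms
(on finitely generated modules). -/
def ExtExtMono [SMulCommClass S R U] (i : ℕ) : Prop :=
  ∀ (X Y : ModuleCat.{0} R), Module.Finite R ↥X → Module.Finite R ↥Y →
    ∀ f : ↥X →ₗ[R] ↥Y, Function.Injective f →
      Function.Injective
        (extMap (R := S) (S := R) U
          (M := ModuleCat.of S (ExtU R S U Y i)) (N := ModuleCat.of S (ExtU R S U X i))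
          (extMap (S := S) U f i) i)

/-- `M` is `U`-`k`-torsionfree: for (every) finitely generated projective presentation
`P₁ → P₀ → M → 0`, with `X = coker (Hom(P₀,U) → Hom(P₁,U))`, one has
`Ext^i_S(X, U) = 0` for `1 ≤ i ≤ k`. -/
def Torsionfree [SMulCommClass S R U] (k : ℕ) (M : ModuleCat.{0} R) : Prop :=
  ∀ (P₁ P₀ : ModuleCat.{0} R), Module.Finite R ↥P₁ → Module.Projective R ↥P₁ →
    Module.Finite R ↥P₀ → Module.Projective R ↥P₀ →
    ∀ (f : ↥P₁ →ₗ[R] ↥P₀) (g : ↥P₀ →ₗ[R] ↥M), Function.Surjective g →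
      LinearMap.range f = LinearMap.ker g →
      ∀ i, 1 ≤ i → i ≤ k →
        extVanish S R U
          (ModuleCat.of S ((↥P₁ →ₗ[R] U) ⧸ LinearMap.range (precompS R S U f))) i

end Ext

section Resol

variable (R : Type) [Ring R] (U : Type) [AddCommGroup U] [Module R U]

/-- `A` belongs to `add U`: it is (isomorphic to) a direct summand of a finite direct
sum of copies of `U`. -/
def InAdd (A : ModuleCat.{0} R) : Prop :=
  ∃ (m : ℕ) (i : ↥A →ₗ[R] (Fin m → U)) (p : (Fin m → U) →ₗ[R] ↥A),
    p.comp i = LinearMap.id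

/-- `U`-resolution dimension of `A` is at most `n` : there is an exact sequence
`0 → U_n → ⋯ → U_0 → A → 0` with all `U_i` in `add U`. -/
def URdimLE : ℕ → ModuleCat.{0} R → Prop
  | 0, A => InAdd R U A
  | n + 1, A => ∃ V : ModuleCat.{0} R, InAdd R U V ∧
      ∃ g : ↥V →ₗ[R] ↥A, Function.Surjective g ∧
        URdimLE n (ModuleCat.of R ↥(LinearMap.ker g))

/-- The `U`-resolution dimension of `A`, as an element of `ℕ∞`. -/
def URdim (A : ModuleCat.{0} R) : ℕ∞ :=
  sInf {c : ℕ∞ | ∃ n : ℕ, c = n ∧ URdimLE R U n A}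

/-- `M` is a `k`-syzygy module: there is an exact sequence
`0 → M → P_{k-1} → ⋯ → P_0 → X → 0` with all `P_i` finitely generated projective. -/
def IsSyzygy : ℕ → ModuleCat.{0} R → Prop
  | 0, _ => True
  | k + 1, M => ∃ P : ModuleCat.{0} R, Module.Finite R ↥P ∧ Module.Projective R ↥P ∧
      ∃ f : ↥M →ₗ[R] ↥P, Function.Injective f ∧
        IsSyzygy k (ModuleCat.of R (↥P ⧸ LinearMap.range f))

/-- `M` is a `U`-`k`-syzygy module: there is an exact sequence
`0 → M → X_0 → X_1 → ⋯ → X_{k-1}` with all `X_i` in `add U`. -/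
def IsUSyzygy : ℕ → ModuleCat.{0} R → Prop
  | 0, _ => True
  | k + 1, M => ∃ V : ModuleCat.{0} R, InAdd R U V ∧
      ∃ f : ↥M →ₗ[R] ↥V, Function.Injective f ∧
        IsUSyzygy k (ModuleCat.of R (↥V ⧸ LinearMap.range f))

/-- The injective dimension of `A` is at most `n` : there is an injective resolution
`0 → A → E_0 → ⋯ → E_n → 0`. -/
def injDimLE : ℕ → ModuleCat.{0} R → Prop
  | 0, A => Module.Injective R ↥A
  | n + 1, A => ∃ E : ModuleCat.{0} R, Module.Injective R ↥E ∧
      ∃ f : ↥A →ₗ[R] ↥E, Function.Injective f ∧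
        injDimLE n (ModuleCat.of R (↥E ⧸ LinearMap.range f))

/-- The injective dimension of `A`, as an element of `ℕ∞`. -/
def injDim (A : ModuleCat.{0} R) : ℕ∞ :=
  sInf {c : ℕ∞ | ∃ n : ℕ, c = n ∧ injDimLE R n A}

/-- `A` is a flat `R`-module (equational criterion for flatness, which makes sense
over an arbitrary, possibly noncommutative, ring): every relation in `A` can be
trivialized. -/
def IsFlat (A : Type) [AddCommGroup A] [Module R A] : Prop :=
  ∀ (n : ℕ) (a : Fin n → R) (x : Fin n → A), (∑ i, a i • x i) = 0 →
    ∃ (k : ℕ) (b : Fin n → Fin k → R) (y : Fin k → A),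
      (∀ i, x i = ∑ j, b i j • y j) ∧ ∀ j, (∑ i, a i * b i j) = 0

/-- The flat dimension of `A` is at most `n` : there is a flat resolution
`0 → F_n → ⋯ → F_0 → A → 0`. -/
def flatDimLE : ℕ → ModuleCat.{0} R → Prop
  | 0, A => IsFlat R ↥A
  | n + 1, A => ∃ F : ModuleCat.{0} R, IsFlat R ↥F ∧
      ∃ g : ↥F →ₗ[R] ↥A, Function.Surjective g ∧
        flatDimLE n (ModuleCat.of R ↥(LinearMap.ker g))

/-- `A` is cogenerated by `U` : it embeds into a direct product of copies of `U`. -/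
def Cogenerated (A : ModuleCat.{0} R) : Prop :=
  ∃ (ι : Type) (f : ↥A →ₗ[R] (ι → U)), Function.Injective f

/-- A minimal injective resolution `0 → M → E 0 → E 1 → ⋯` of `M` : an injective
resolution in which the kernel of each differential is an essential submodule. -/
structure MinInjRes (M : Type) [AddCommGroup M] [Module R M] where
  E : ℕ → ModuleCat.{0} R
  injective : ∀ n, Module.Injective R ↥(E n)
  ι : M →ₗ[R] ↥(E 0)
  d : ∀ n, ↥(E n) →ₗ[R] ↥(E (n + 1))
  ι_inj : Function.Injective ι
  exact_zero : LinearMap.ker (d 0) = LinearMap.range ι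
  exact_succ : ∀ n, LinearMap.ker (d (n + 1)) = LinearMap.range (d n)
  essential : ∀ n (B : Submodule R ↥(E n)), B ⊓ LinearMap.ker (d n) = ⊥ → B = ⊥

end Resol

section Bimodule

variable (Λ Γ : Type) [Ring Λ] [Ring Γ]
variable (U : Type) [AddCommGroup U] [Module Λ U] [Module Γᵐᵒᵖ U]
  [SMulCommClass Λ Γᵐᵒᵖ U] [SMulCommClass Γᵐᵒᵖ Λ U]

/-- Left multiplication `u ↦ a • u` as a `Γᵒᵖ`-linear endomorphism of `U`. -/
def lmul (a : Λ) : U →ₗ[Γᵐᵒᵖ] U where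
  toFun u := a • u
  map_add' := smul_add a
  map_smul' γ u := smul_comm a γ u

/-- Right multiplication `u ↦ u γ` as a `Λ`-linear endomorphism of `U`. -/
def rmul (γ : Γᵐᵒᵖ) : U →ₗ[Λ] U where
  toFun u := γ • u
  map_add' := smul_add γ
  map_smul' a u := smul_comm γ a u

/-- `U` is a faithfully balanced `(Λ,Γ)`-bimodule: the natural maps
`Λ → End(U_Γ)` and `Γ → End(_ΛU)^op` are isomorphisms. -/
def FaithfullyBalanced : Prop :=
  Function.Bijective (lmul Λ Γ U) ∧ Function.Bijective (rmul Λ Γ U)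

/-- `U` is selforthogonal: `Ext^i_Λ(U,U) = 0 = Ext^i_Γ(U,U)` for all `i ≥ 1`. -/
def SelfOrthogonal : Prop :=
  (∀ i, 1 ≤ i → extVanish Λ Γᵐᵒᵖ U (ModuleCat.of Λ U) i) ∧
  (∀ i, 1 ≤ i → extVanish Γᵐᵒᵖ Λ U (ModuleCat.of Γᵐᵒᵖ U) i)

/-- `_ΛU` is `k`-Gorenstein : `s.grade_U Ext^i_Γ(N,U) ≥ i` for every
`N ∈ mod Γᵒᵖ` and all `1 ≤ i ≤ k`. -/
def LeftGorenstein (k : ℕ) : Prop :=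
  ∀ N : ModuleCat.{0} Γᵐᵒᵖ, Module.Finite Γᵐᵒᵖ ↥N →
    ∀ i, 1 ≤ i → i ≤ k →
      sgradeGE Λ Γᵐᵒᵖ U (ModuleCat.of Λ (ExtU Γᵐᵒᵖ Λ U N i)) i

/-- `U_Γ` is `k`-Gorenstein : `s.grade_U Ext^i_Λ(M,U) ≥ i` for every
`M ∈ mod Λ` and all `1 ≤ i ≤ k`. -/
def RightGorenstein (k : ℕ) : Prop :=
  ∀ M : ModuleCat.{0} Λ, Module.Finite Λ ↥M →
    ∀ i, 1 ≤ i → i ≤ k →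
      sgradeGE Γᵐᵒᵖ Λ U (ModuleCat.of Γᵐᵒᵖ (ExtU Λ Γᵐᵒᵖ U M i)) i

end Bimodule

section Helpers

open CategoryTheory CategoryTheory.Abelian

variable {R : Type} [Ring R]

/-- The short complex attached to an injection, a surjection, exact in the middle. -/
def sesOf {A B C : ModuleCat.{0} R} (f : ↥A →ₗ[R] ↥B) (g : ↥B →ₗ[R] ↥C)
    (h : LinearMap.range f = LinearMap.ker g) : ShortComplex (ModuleCat.{0} R) :=
  ShortComplex.mk (ModuleCat.ofHom f) (ModuleCat.ofHom g) (by
    ext x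
    have : f x ∈ LinearMap.ker g := h ▸ LinearMap.mem_range_self f x
    simpa using this)

lemma sesOf_shortExact {A B C : ModuleCat.{0} R} (f : ↥A →ₗ[R] ↥B) (g : ↥B →ₗ[R] ↥C)
    (h : LinearMap.range f = LinearMap.ker g) (hf : Function.Injective f)
    (hg : Function.Surjective g) : (sesOf f g h).ShortExact where
  exact := by
    rw [ShortComplex.moduleCat_exact_iff]
    intro x hx
    have : x ∈ LinearMap.range f := by rw [h]; exact hx
    exact this
  mono_f := (ModuleCat.mono_iff_injective _).2 hf
  epi_g := (ModuleCat.epi_iff_surjective _).2 hg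

lemma cover_surjective (M : Type) [AddCommGroup M] [Module R M] :
    Function.Surjective (cover R M) := fun m =>
  ⟨Finsupp.single m 1, by simp [cover]⟩

/-- The canonical short exact sequence `0 → Ω M → F M → M → 0`. -/
def covSes (M : ModuleCat.{0} R) : ShortComplex (ModuleCat.{0} R) :=
  sesOf (A := ModuleCat.of R (LinearMap.ker (cover R M))) (B := ModuleCat.of R (↥M →₀ R)) (C := M)
    (LinearMap.ker (cover R M)).subtype (cover R M) (Submodule.range_subtype _)

lemma covSes_shortExact (M : ModuleCat.{0} R) : (covSes M).ShortExact :=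
  sesOf_shortExact _ _ _ (Submodule.injective_subtype _) (cover_surjective _)

instance (M : ModuleCat.{0} R) : Projective (covSes M).X₂ :=
  (IsProjective.iff_projective (R := R) (↥M →₀ R)).1 inferInstance

/-- The extension class of the canonical sequence. -/
def dcl (M : ModuleCat.{0} R) : Ext M (syz R M 1) 1 := (covSes_shortExact M).extClass

lemma dcl_comp_zero (M : ModuleCat.{0} R) {V : ModuleCat.{0} R}
    (z : (covSes M).X₂ ⟶ V) :
    (covSes_shortExact M).extClass.comp (Ext.mk₀ ((covSes M).f ≫ z)) (add_zero 1) = 0 := by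
  rw [← Ext.mk₀_comp_mk₀]
  exact ShortComplex.ShortExact.extClass_comp_assoc (covSes_shortExact M) _

lemma covSes_naturality {M N : ModuleCat.{0} R} (f : ↥M →ₗ[R] ↥N) :
    (dcl M).comp (Ext.mk₀ (ModuleCat.ofHom (kerMap f) :
      ModuleCat.of R (LinearMap.ker (cover R M)) ⟶ ModuleCat.of R (LinearMap.ker (cover R N))))
      (add_zero 1) = (Ext.mk₀ (ModuleCat.ofHom f)).comp (dcl N) (zero_add 1) := by
  let φ : covSes M ⟶ covSes N :=
    { τ₁ := ModuleCat.ofHom (kerMap f)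
      τ₂ := ModuleCat.ofHom (freeMap f)
      τ₃ := ModuleCat.ofHom f
      comm₁₂ := by
        apply ModuleCat.hom_ext
        apply LinearMap.ext
        intro x
        rfl
      comm₂₃ := by
        apply ModuleCat.hom_ext
        exact cover_comp_freeMap R f }
  exact (ShortComplex.ShortExact.extClass_naturality (covSes_shortExact M)
    (covSes_shortExact N) φ)

variable (R) in
/-- The iterated extension class in `Ext^n(M, Ω^n M)`. -/
def ccl (M : ModuleCat.{0} R) : ∀ n : ℕ, Ext M (syz R M n) n
  | 0 => Ext.mk₀ (𝟙 M)
  | n + 1 => (ccl M n).comp (dcl (syz R M n)) rfl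

lemma ccl_naturality {M N : ModuleCat.{0} R} (f : ↥M →ₗ[R] ↥N) (n : ℕ) :
    (ccl R M n).comp (Ext.mk₀ (ModuleCat.ofHom (syzMap f n))) (add_zero n) =
      (Ext.mk₀ (ModuleCat.ofHom f)).comp (ccl R N n) (zero_add n) := by
  induction n with
  | zero =>
    change (Ext.mk₀ (𝟙 M)).comp (Ext.mk₀ (ModuleCat.ofHom f)) _ =
      (Ext.mk₀ (ModuleCat.ofHom f)).comp (Ext.mk₀ (𝟙 N)) _
    rw [Ext.mk₀_id_comp, Ext.comp_mk₀_id]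
  | succ n ih =>
    have h1 := covSes_naturality (syzMap f n)
    change ((ccl R M n).comp (dcl (syz R M n)) rfl).comp (Ext.mk₀ (ModuleCat.ofHom
      (kerMap (syzMap f n)))) (add_zero _) = (Ext.mk₀ (ModuleCat.ofHom f)).comp
        ((ccl R N n).comp (dcl (syz R N n)) rfl) (zero_add _)
    refine (Ext.comp_assoc_of_third_deg_zero _ _ _ _).trans ?_
    rw [← Ext.comp_assoc (Ext.mk₀ (ModuleCat.ofHom f)) _ _ (zero_add n) rfl (by omega), ← ih]
    rw [Ext.comp_assoc_of_second_deg_zero]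
    exact congrArg (fun z => (ccl R M n).comp z rfl) h1

lemma dcl_bij (M V : ModuleCat.{0} R) (j j' : ℕ) (h : 1 + (j + 1) = j') :
    Function.Bijective (fun x : Ext (syz R M 1) V (j + 1) => (dcl M).comp x h) := by
  constructor
  · intro x y hxy
    have h0 : (dcl M).comp (x - y) h = 0 := by
      rw [sub_eq_add_neg, Ext.comp_add, Ext.comp_neg]
      exact add_neg_eq_zero.2 hxy
    obtain ⟨z, hz⟩ := Ext.contravariant_sequence_exact₁ (covSes_shortExact M) V (x - y) h h0
    rw [Ext.eq_zero_of_projective z, Ext.comp_zero] at hz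
    exact (sub_eq_zero.1 hz.symm)
  · intro y
    subst h
    obtain ⟨x, hx⟩ := Ext.contravariant_sequence_exact₃ (covSes_shortExact M) V y
      (by
        have h2 : (1 + (j + 1)) = (j + 1) + 1 := by omega
        have : Subsingleton (Ext (covSes M).X₂ V (1 + (j + 1))) := by
          rw [h2]; exact Ext.subsingleton_of_projective _ _ _
        exact Subsingleton.elim _ _) rfl
    exact ⟨x, hx⟩

lemma ccl_bij (M V : ModuleCat.{0} R) (n : ℕ) : ∀ (j j' : ℕ) (h : n + (j + 1) = j'),
    Function.Bijective (fun x : Ext (syz R M n) V (j + 1) => (ccl R M n).comp x h) := by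
  induction n with
  | zero =>
    intro j j' h
    obtain rfl : j + 1 = j' := by omega
    have : (fun x : Ext (syz R M 0) V (j + 1) => (ccl R M 0).comp x h) = fun x => x := by
      funext x
      exact Ext.mk₀_id_comp x
    rw [this]
    exact Function.bijective_id
  | succ n ih =>
    intro j j' h
    have := (ih (j + 1) j' (by omega)).comp (dcl_bij (syz R M n) V j (j + 1 + 1) (by omega))
    have key : ∀ x : Ext (syz R M (n + 1)) V (j + 1), (ccl R M (n + 1)).comp x h =
        (ccl R M n).comp ((dcl (syz R M n)).comp x (Nat.add_comm 1 (j + 1))) (by omega) :=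
      fun x => Ext.comp_assoc _ _ _ _ _ (by omega)
    exact ⟨fun x y hxy => this.1 (((key x).symm.trans hxy).trans (key y)),
      fun y => (this.2 y).imp fun x hx => (key x).trans hx⟩

variable {S : Type} [Ring S]
variable {U : Type} [AddCommGroup U] [Module R U] [Module S U] [SMulCommClass R S U]

variable (U) in
/-- Yoneda product of the iterated class with a homomorphism. -/
def phi (M : ModuleCat.{0} R) (n : ℕ) :
    (↥(syz R M n) →ₗ[R] U) →+ Ext M (ModuleCat.of R U) n :=
  AddMonoidHom.mk' (fun g => (ccl R M n).comp (Ext.mk₀ (ModuleCat.ofHom g)) (add_zero n))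
    (fun g h => by
      rw [ModuleCat.ofHom_add, Ext.mk₀_add, Ext.comp_add])

lemma phi_apply (M : ModuleCat.{0} R) (n : ℕ) (g : ↥(syz R M n) →ₗ[R] U) :
    phi U M n g = (ccl R M n).comp (Ext.mk₀ (ModuleCat.ofHom g)) (add_zero n) := rfl

lemma phi_succ_apply (M : ModuleCat.{0} R) (n : ℕ) (g : ↥(syz R M (n + 1)) →ₗ[R] U) :
    phi U M (n + 1) g = (ccl R M n).comp ((dcl (syz R M n)).comp
      (Ext.mk₀ (Y := ModuleCat.of R U) (ModuleCat.ofHom g)) (add_zero 1)) rfl :=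
  Ext.comp_assoc_of_third_deg_zero _ _ _ _

variable (S) in
lemma phi_eq_zero_iff (M : ModuleCat.{0} R) (n : ℕ) (g : ↥(syz R M (n + 1)) →ₗ[R] U) :
    phi U M (n + 1) g = 0 ↔ g ∈ ext1Sub R S U ↥(syz R M n) := by
  have key : phi U M (n + 1) g = 0 ↔ (dcl (syz R M n)).comp
      (Ext.mk₀ (Y := ModuleCat.of R U) (ModuleCat.ofHom g)) (add_zero 1) = 0 := by
    rw [phi_succ_apply]
    constructor
    · intro h
      apply (ccl_bij M (ModuleCat.of R U) n 0 (n + 1) rfl).1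
      change (ccl R M n).comp _ _ = (ccl R M n).comp _ _
      rw [h, Ext.comp_zero]
    · intro h
      rw [h, Ext.comp_zero]
  rw [key]
  constructor
  · intro h
    obtain ⟨z, hz⟩ := Ext.contravariant_sequence_exact₁ (covSes_shortExact (syz R M n))
      (ModuleCat.of R U) _ (add_zero 1) h
    obtain ⟨z, rfl⟩ := (Ext.mk₀_bijective _ _).2 z
    rw [Ext.mk₀_comp_mk₀] at hz
    have h2 := (Ext.mk₀_bijective _ _).1 hz
    have h3 := congrArg ModuleCat.Hom.hom h2
    exact ⟨z.hom, h3⟩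
  · rintro ⟨z, rfl⟩
    exact dcl_comp_zero (syz R M n) (ModuleCat.ofHom z)

lemma phi_surj (M : ModuleCat.{0} R) (n : ℕ) : Function.Surjective (phi U M n) := by
  intro y
  cases n with
  | zero =>
    obtain ⟨z, rfl⟩ := (Ext.mk₀_bijective _ _).2 y
    exact ⟨z.hom, Ext.mk₀_id_comp _⟩
  | succ n =>
    obtain ⟨x, hx⟩ := (ccl_bij M (ModuleCat.of R U) n 0 (n + 1) rfl).2 y
    obtain ⟨z, hz⟩ := Ext.contravariant_sequence_exact₃ (covSes_shortExact (syz R M n))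
      (ModuleCat.of R U) x (by
        have : Subsingleton (Ext (covSes (syz R M n)).X₂ (ModuleCat.of R U) (0 + 1)) :=
          Ext.subsingleton_of_projective _ _ _
        exact Subsingleton.elim _ _) (n₀ := 0) rfl
    obtain ⟨z, rfl⟩ := (Ext.mk₀_bijective _ _).2 z
    refine ⟨z.hom, ?_⟩
    refine (phi_succ_apply M n _).trans (Eq.trans ?_ hx)
    exact congrArg (fun t => (ccl R M n).comp t rfl) hz

variable (S U) in
/-- The comparison map from the concrete Ext groups to Mathlib's. -/
def Phi (M : ModuleCat.{0} R) : ∀ n : ℕ, ExtU R S U M n →+ Ext M (ModuleCat.of R U) n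
  | 0 => phi U M 0
  | n + 1 => QuotientAddGroup.lift (ext1Sub R S U ↥(syz R M n)).toAddSubgroup
      (phi U M (n + 1)) (fun g hg => (phi_eq_zero_iff S M n g).2 hg)

variable (S U) in
/-- The quotient map onto the concrete Ext groups. -/
def cls (M : ModuleCat.{0} R) : ∀ n : ℕ, (↥(syz R M n) →ₗ[R] U) →ₗ[S] ExtU R S U M n
  | 0 => LinearMap.id
  | n + 1 => (ext1Sub R S U ↥(syz R M n)).mkQ

lemma cls_surj (M : ModuleCat.{0} R) (n : ℕ) : Function.Surjective (cls S U M n) := by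
  cases n with
  | zero => exact Function.surjective_id
  | succ n => exact Submodule.mkQ_surjective _

lemma Phi_cls (M : ModuleCat.{0} R) (n : ℕ) (g) : Phi S U M n (cls S U M n g) = phi U M n g := by
  cases n <;> rfl

lemma Phi_bij (M : ModuleCat.{0} R) (n : ℕ) : Function.Bijective (Phi S U M n) := by
  constructor
  · rw [injective_iff_map_eq_zero]
    intro x hx
    obtain ⟨g, rfl⟩ := cls_surj M n x
    rw [Phi_cls] at hx
    cases n with
    | zero =>
      have h1 : Ext.mk₀ (ModuleCat.ofHom g : M ⟶ ModuleCat.of R U) = 0 :=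
        (Ext.mk₀_id_comp _).symm.trans hx
      rw [Ext.mk₀_eq_zero_iff] at h1
      exact congrArg ModuleCat.Hom.hom h1
    | succ n => exact (Submodule.Quotient.mk_eq_zero _).2 ((phi_eq_zero_iff S M n g).1 hx)
  · intro y
    obtain ⟨g, rfl⟩ := phi_surj M n y
    exact ⟨cls S U M n g, Phi_cls M n g⟩

lemma extMap_cls {M N : ModuleCat.{0} R} (f : ↥M →ₗ[R] ↥N) (n : ℕ) (g : ↥(syz R N n) →ₗ[R] U) :
    extMap S U f n (cls S U N n g) = cls S U M n (g.comp (syzMap f n)) := by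
  cases n <;> rfl

lemma Phi_extMap {M N : ModuleCat.{0} R} (f : ↥M →ₗ[R] ↥N) (n : ℕ) (x : ExtU R S U N n) :
    Phi S U M n (extMap S U f n x) =
      (Ext.mk₀ (ModuleCat.ofHom f)).comp (Phi S U N n x) (zero_add n) := by
  obtain ⟨g, rfl⟩ := cls_surj N n x
  rw [extMap_cls, Phi_cls, Phi_cls, phi_apply, phi_apply, ModuleCat.ofHom_comp, ← Ext.mk₀_comp_mk₀,
    ← Ext.comp_assoc_of_third_deg_zero, ccl_naturality, Ext.comp_assoc_of_third_deg_zero]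

variable (R U) in
/-- The action of `s : S` on `U` as an `R`-linear endomorphism. -/
def actR (s : S) : U →ₗ[R] U where
  toFun u := s • u
  map_add' := smul_add s
  map_smul' r u := (smul_comm r s u).symm

lemma Phi_smul (M : ModuleCat.{0} R) (n : ℕ) (s : S) (x : ExtU R S U M n) :
    Phi S U M n (s • x) =
      (Phi S U M n x).comp (Ext.mk₀ (ModuleCat.ofHom (actR R U s))) (add_zero n) := by
  obtain ⟨g, rfl⟩ := cls_surj M n x
  rw [← map_smul, Phi_cls, Phi_cls, phi_apply, phi_apply, Ext.comp_assoc_of_third_deg_zero,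
    Ext.mk₀_comp_mk₀]
  rfl

lemma extVanish_iff (M : ModuleCat.{0} R) (n : ℕ) :
    extVanish R S U M n ↔ Subsingleton (Ext M (ModuleCat.of R U) n) :=
  (Equiv.ofBijective _ (Phi_bij (S := S) (U := U) M n)).subsingleton_congr

lemma extMap_inj {M N : ModuleCat.{0} R} (f : ↥M →ₗ[R] ↥N) (n : ℕ)
    (h : ∀ y : Ext N (ModuleCat.of R U) n,
      (Ext.mk₀ (ModuleCat.ofHom f)).comp y (zero_add n) = 0 → y = 0) :
    Function.Injective (extMap S U f n) := by
  rw [injective_iff_map_eq_zero]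
  intro x hx
  apply (Phi_bij N n).1
  rw [map_zero]
  apply h
  rw [← Phi_extMap, hx, map_zero]

lemma extVanish_of_equiv {M N : ModuleCat.{0} R} (e : ↥M ≃ₗ[R] ↥N) (n : ℕ)
    (h : extVanish R S U N n) : extVanish R S U M n := by
  rw [extVanish_iff] at h ⊢
  refine ⟨fun x y => ?_⟩
  have h1 : ∀ x : Ext M (ModuleCat.of R U) n, x = 0 := by
    intro x
    have h2 : (Ext.mk₀ (ModuleCat.ofHom e.toLinearMap)).comp
        ((Ext.mk₀ (ModuleCat.ofHom e.symm.toLinearMap)).comp x (zero_add n)) (zero_add n) = x := by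
      rw [Ext.mk₀_comp_mk₀_assoc]
      have : (ModuleCat.ofHom e.toLinearMap : M ⟶ N) ≫ ModuleCat.ofHom e.symm.toLinearMap = 𝟙 M := by
        ext x
        simp
      rw [this, Ext.mk₀_id_comp]
    rw [← h2, Subsingleton.elim (Ext.comp _ x _) 0, Ext.comp_zero]
  rw [h1 x, h1 y]

/-- The cokernel of `Ext^i(Y,U) → Ext^i(X,U)` embeds linearly in `Ext^{i+1}(Z,U)`. -/
lemma exists_connecting {X Y Z : ModuleCat.{0} R} (f : ↥X →ₗ[R] ↥Y) (g : ↥Y →ₗ[R] ↥Z)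
    (h : LinearMap.range f = LinearMap.ker g) (hf : Function.Injective f)
    (hg : Function.Surjective g) (i : ℕ) :
    ∃ d : ExtU R S U X i →ₗ[S] ExtU R S U Z (i + 1),
      LinearMap.ker d = LinearMap.range (extMap S U f i) := by
  let hS := sesOf_shortExact f g h hf hg
  let δ : Ext Z X 1 := hS.extClass
  let eZ := AddEquiv.ofBijective _ (Phi_bij (S := S) (U := U) Z (i + 1))
  have hd : ∀ x : Ext X (ModuleCat.of R U) i, Phi S U Z (i + 1)
      (eZ.symm (δ.comp x (Nat.add_comm 1 i))) =
      δ.comp x (Nat.add_comm 1 i) := fun x => eZ.apply_symm_apply _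
  refine ⟨{ toFun := fun x => eZ.symm (δ.comp (Phi S U X i x) (Nat.add_comm 1 i))
            map_add' := fun x y => ?_
            map_smul' := fun s x => ?_ }, ?_⟩
  · apply (Phi_bij Z (i + 1)).1
    rw [map_add (Phi S U Z (i + 1)), hd, hd, hd, map_add, Ext.comp_add]
  · apply (Phi_bij Z (i + 1)).1
    rw [RingHom.id_apply, hd, Phi_smul, Phi_smul, hd, Ext.comp_assoc_of_third_deg_zero]
  · ext x
    rw [LinearMap.mem_ker, LinearMap.mem_range]
    change eZ.symm (δ.comp (Phi S U X i x) (Nat.add_comm 1 i)) = 0 ↔ _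
    rw [AddEquiv.map_eq_zero_iff]
    constructor
    · intro h0
      obtain ⟨y, hy⟩ := Ext.contravariant_sequence_exact₁ hS _ _ _ h0
      obtain ⟨y, rfl⟩ := (Phi_bij (S := S) (U := U) Y i).2 y
      refine ⟨y, (Phi_bij X i).1 ?_⟩
      rw [Phi_extMap]
      exact hy
    · rintro ⟨y, rfl⟩
      rw [Phi_extMap]
      exact ShortComplex.ShortExact.extClass_comp_assoc hS _

/-- The homological core: if the cokernel of `a` has vanishing `Ext^i` and the kernel of `a`
has vanishing `Ext^{i-1}` then `a` induces an injection on `Ext^i`. -/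
lemma extMap_inj_of_vanish {A B : ModuleCat.{0} R} (a : ↥A →ₗ[R] ↥B) (i : ℕ)
    (hC : extVanish R S U (ModuleCat.of R (↥B ⧸ LinearMap.range a)) i)
    (hK : ∀ j, j + 1 = i → extVanish R S U (ModuleCat.of R ↥(LinearMap.ker a)) j) :
    Function.Injective (extMap S U a i) := by
  apply extMap_inj
  intro y hy
  let I : ModuleCat.{0} R := ModuleCat.of R ↥(LinearMap.range a)
  let h1 := sesOf_shortExact (A := I) (B := B)
    (C := ModuleCat.of R (↥B ⧸ LinearMap.range a)) (LinearMap.range a).subtype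
    (LinearMap.range a).mkQ (by rw [Submodule.range_subtype, Submodule.ker_mkQ])
    (Submodule.injective_subtype _) (Submodule.mkQ_surjective _)
  let h2 := sesOf_shortExact (A := ModuleCat.of R ↥(LinearMap.ker a)) (B := A)
    (C := I) (LinearMap.ker a).subtype
    a.rangeRestrict (by rw [Submodule.range_subtype, LinearMap.ker_rangeRestrict])
    (Submodule.injective_subtype _) (LinearMap.surjective_rangeRestrict _)
  have hfac : (ModuleCat.ofHom a : A ⟶ B) = (ModuleCat.ofHom a.rangeRestrict : A ⟶ I) ≫
    (ModuleCat.ofHom (LinearMap.range a).subtype : I ⟶ B) := rfl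
  rw [hfac, ← Ext.mk₀_comp_mk₀_assoc] at hy
  have hz : (Ext.mk₀ (ModuleCat.ofHom (LinearMap.range a).subtype : I ⟶ B)).comp y (zero_add i)
      = 0 := by
    cases i with
    | zero =>
      have : Epi (ModuleCat.ofHom a.rangeRestrict : A ⟶ I) := h2.epi_g
      apply Ext.precomp_mk₀_injective_of_epi _ (ModuleCat.ofHom a.rangeRestrict : A ⟶ I)
      rw [map_zero]
      exact hy
    | succ j =>
      obtain ⟨w, hw⟩ := Ext.contravariant_sequence_exact₃ h2 _ _ hy (Nat.add_comm 1 j)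
      have := (extVanish_iff _ _).1 (hK j rfl)
      have hw0 : w = 0 := this.elim _ _
      rw [hw0] at hw
      exact hw.symm.trans (Ext.comp_zero _ _ _ _ _)
  obtain ⟨w, hw⟩ := Ext.contravariant_sequence_exact₂ h1 _ y hz
  have := (extVanish_iff _ _).1 hC
  have hw0 : w = 0 := this.elim _ _
  rw [hw0] at hw
  exact hw.symm.trans (Ext.comp_zero _ _ _ _ _)

end Helpers

section Statement

variable (R₀ : Type) [CommRing R₀] [IsArtinianRing R₀]
variable (Λ Γ : Type) [Ring Λ] [Ring Γ] [Algebra R₀ Λ] [Algebra R₀ Γ]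
  [Module.Finite R₀ Λ] [Module.Finite R₀ Γ]
variable (U : Type) [AddCommGroup U] [Module Λ U] [Module Γᵐᵒᵖ U]
  [SMulCommClass Λ Γᵐᵒᵖ U] [SMulCommClass Γᵐᵒᵖ Λ U]
  [Module.Finite Λ U] [Module.Finite Γᵐᵒᵖ U]

/-- **Lemma 3.1.** If `_ΛU` is `k`-Gorenstein, then for every `0 ≤ i ≤ k-1` the functor
`Ext^i_Λ(Ext^i_Γ(-,U),U) : mod Γᵒᵖ → mod Γᵒᵖ` preserves monomorphisms. -/
theorem extExt_preserves_mono_of_leftGorenstein (k : ℕ)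
    (hfb : FaithfullyBalanced Λ Γ U) (hso : SelfOrthogonal Λ Γ U)
    (hgor : LeftGorenstein Λ Γ U k) :
    ∀ i < k, ExtExtMono Γᵐᵒᵖ Λ U i := by
  intro i hi X Y hX hY f hf
  let Z : ModuleCat.{0} Γᵐᵒᵖ := ModuleCat.of Γᵐᵒᵖ (↥Y ⧸ LinearMap.range f)
  have hZ : Module.Finite Γᵐᵒᵖ ↥Z := Module.Finite.quotient _ _
  obtain ⟨d, hd⟩ := exists_connecting (S := Λ) (U := U) (X := X) (Y := Y) (Z := Z) f
    (LinearMap.range f).mkQ (Submodule.ker_mkQ _).symm hf (Submodule.mkQ_surjective _) i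
  refine extMap_inj_of_vanish (S := Γᵐᵒᵖ) (U := U)
    (A := ModuleCat.of Λ (ExtU Γᵐᵒᵖ Λ U Y i)) (B := ModuleCat.of Λ (ExtU Γᵐᵒᵖ Λ U X i))
    (extMap Λ U f i) i ?_ ?_
  · have h1 := hgor Z hZ (i + 1) (by omega) (by omega) (LinearMap.range d) i (by omega)
    exact extVanish_of_equiv (N := ModuleCat.of Λ ↥(LinearMap.range d))
      ((Submodule.quotEquivOfEq _ _ hd.symm).trans d.quotKerEquivRange) i h1
  · intro j hj
    exact hgor Y hY i (by omega) (by omega) (LinearMap.ker (extMap Λ U f i)) j (by omega)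

end Statement

end GorPaper
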